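/- arXiv:1205.0503 — 8 statements merged into one kernel-verified Lean document; each statement's English description precedes it below -/
import Mathlib

section
/- Let n be a positive integer, S ⊆ ℤ_n \ {0} with S = -S, and let α be a graph automorphism of the circulant graph Circ(n;S) that respects the partition 𝒞 and fixes the vertex 0. Suppose s, s' ∈ S, that n = n₁·n₂ with gcd(n₁,n₂) = 1, that the cyclic subgroup ⟨n₂⟩ of ℤ_n is contained in ⟨s⟩, and that α(s) ≡ j·s (mod n₁) for some integer j. Then α(s') ≡ j·s' (mod n₁). -/
/-- The circulant graph `Circ(n; S)`: vertices are `ZMod n`, with `g ~ h` iff `h - g ∈ S`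
(given that `S` is symmetric and does not contain `0`). -/
def Circ (n : ℕ) (S : Set (ZMod n)) : SimpleGraph (ZMod n) :=
  SimpleGraph.fromRel (fun g h => h - g ∈ S)

/-- The part of the partition `𝒞` determined by the connection-set element `s` and the
coset `x + ⟨s⟩`: the set of edges `{g, g+s}` with `g ∈ x + ⟨s⟩`. -/
def cyclePart {n : ℕ} (s x : ZMod n) : Set (Sym2 (ZMod n)) :=
  {e | ∃ g : ZMod n, g - x ∈ AddSubgroup.zmultiples s ∧ e = s(g, g + s)}

/-- A vertex map `f` respects the partition `𝒞` if the image of every part of `𝒞`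
is again a part of `𝒞`. -/
def RespectsC {n : ℕ} (S : Set (ZMod n)) (f : ZMod n → ZMod n) : Prop :=
  ∀ s ∈ S, ∀ x : ZMod n, ∃ s' ∈ S, ∃ x' : ZMod n,
    Sym2.map f '' cyclePart s x = cyclePart s' x'

theorem alpha_mul {n : ℕ} (S : Set (ZMod n)) (f : ZMod n → ZMod n)
    (hf : Function.Injective f) (h0 : f 0 = 0) (hC : RespectsC S f) (s : ZMod n) (hs : s ∈ S) (k : ℕ) :
    f (k * s) = k * f s := by
  obtain ⟨t, -, x, h⟩ := hC s hs 0
  have key : ∀ k : ℕ, s(f (k * s), f (k * s + s)) ∈ cyclePart t x := by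
    intro k
    rw [← h]
    refine ⟨s(k * s, k * s + s), ⟨k * s, ?_, rfl⟩, rfl⟩
    rw [sub_zero, AddSubgroup.mem_zmultiples_iff]
    exact ⟨k, by simp⟩
  have diff : ∀ k : ℕ, f (k * s + s) = f (k * s) + t ∨ f (k * s + s) = f (k * s) - t := by
    intro k
    obtain ⟨g, -, hg⟩ := key k
    rcases Sym2.eq_iff.1 hg with ⟨h1, h2⟩ | ⟨h1, h2⟩
    · left; rw [h1, h2]
    · right; rw [h1, h2]; ring
  have ht : f s = t ∨ f s = -t := by simpa [h0] using diff 0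
  have two : s + s = 0 → t + t = 0 := by
    intro h2
    have all : ∀ e ∈ cyclePart t x, e = s(f 0, f s) := by
      intro e he
      rw [← h] at he
      obtain ⟨_, ⟨g, hg, rfl⟩, rfl⟩ := he
      rw [sub_zero, AddSubgroup.mem_zmultiples_iff] at hg
      obtain ⟨m, rfl⟩ := hg
      rcases Int.even_or_odd' m with ⟨c, rfl | rfl⟩
      · have : (2 * c) • s = 0 := by
          rw [mul_comm, mul_zsmul, two_zsmul, h2, zsmul_zero]
        simp only [this, Sym2.map_mk, zero_add]
      · have : (2 * c + 1) • s = s := by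
          rw [add_zsmul, mul_comm, mul_zsmul, two_zsmul, h2, zsmul_zero]; simp
        simp only [this, Sym2.map_mk, h2]
        exact Sym2.eq_swap
    have e1 := all s(x, x + t) ⟨x, by simp, rfl⟩
    have e2 := all s(x + t, x + t + t) ⟨x + t, by simp, rfl⟩
    rw [← e2] at e1
    rcases Sym2.eq_iff.1 e1 with ⟨h3, h4⟩ | ⟨h3, h4⟩
    · have : t = 0 := by simpa using h3
      simp [this]
    · have : x + (t + t) = x + 0 := by rw [← add_assoc, ← h3, add_zero]
      exact add_left_cancel this
  have two' : s + s = 0 → f s + f s = 0 := by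
    intro h2
    have := two h2
    rcases ht with h | h <;> rw [h]
    · exact this
    · rw [← neg_add, this, neg_zero]
  have main : ∀ k : ℕ, f (k * s) = k * f s ∧ f ((k + 1 : ℕ) * s) = (k + 1 : ℕ) * f s := by
    intro k
    induction k with
    | zero => simp [h0]
    | succ k ih =>
      refine ⟨ih.2, ?_⟩
      by_cases h2 : s + s = 0
      · have e : ((k + 1 + 1 : ℕ) : ZMod n) * s = k * s := by
          push_cast; linear_combination h2
        rw [e, ih.1]
        push_cast; linear_combination -(two' h2)
      · have e : ((k + 1 + 1 : ℕ) : ZMod n) * s = (k + 1 : ℕ) * s + s := by push_cast; ring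
        have hne : f ((k + 1 + 1 : ℕ) * s) ≠ f (k * s) := by
          intro hh
          apply h2
          have := hf hh
          push_cast at this
          linear_combination this
        have hd := diff (k + 1)
        rw [← e, ih.2] at hd
        rw [ih.1] at hne
        push_cast at hd hne ⊢
        rcases ht with ht | ht <;> rcases hd with hd | hd
        · rw [hd, ← ht]; ring
        · exact absurd (by rw [hd, ← ht]; ring) hne
        · exact absurd (by rw [hd]; linear_combination ht) hne
        · rw [hd]; linear_combination -ht
  exact (main k).1

theorem lemma_multiplier (n : ℕ) (hn : 0 < n) (S : Set (ZMod n))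
    (h0S : (0 : ZMod n) ∉ S) (hSsym : S = -S)
    (α : Circ n S ≃g Circ n S) (hα0 : α 0 = 0) (hC : RespectsC S ⇑α)
    (s s' : ZMod n) (hs : s ∈ S) (hs' : s' ∈ S)
    (n₁ n₂ : ℕ) (hfac : n = n₁ * n₂) (hcop : Nat.Coprime n₁ n₂)
    (hsub : AddSubgroup.zmultiples ((n₂ : ZMod n)) ≤ AddSubgroup.zmultiples s)
    (j : ℤ)
    (hj : ZMod.castHom ⟨n₂, hfac⟩ (ZMod n₁) (α s)
        = (j : ZMod n₁) * ZMod.castHom ⟨n₂, hfac⟩ (ZMod n₁) s) :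
    ZMod.castHom ⟨n₂, hfac⟩ (ZMod n₁) (α s')
        = (j : ZMod n₁) * ZMod.castHom ⟨n₂, hfac⟩ (ZMod n₁) s' := by
  have : NeZero n := ⟨hn.ne'⟩
  have hmem : (n₂ : ZMod n) * s' ∈ AddSubgroup.zmultiples s := by
    apply hsub
    rw [AddSubgroup.mem_zmultiples_iff]
    exact ⟨s'.val, by simp [mul_comm]⟩
  rw [AddSubgroup.mem_zmultiples_iff] at hmem
  obtain ⟨m, hm⟩ := hmem
  have hk : (((m : ZMod n).val : ℕ) : ZMod n) * s = n₂ * s' := by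
    rw [← hm]; simp
  have e1 := alpha_mul S α α.injective hα0 hC s hs (m : ZMod n).val
  have e2 := alpha_mul S α α.injective hα0 hC s' hs' n₂
  rw [hk, e2] at e1
  have f1 := congrArg (ZMod.castHom ⟨n₂, hfac⟩ (ZMod n₁)) e1
  have f2 := congrArg (ZMod.castHom ⟨n₂, hfac⟩ (ZMod n₁)) hk
  rw [map_mul, map_mul, map_natCast, map_natCast] at f1 f2
  rw [hj] at f1
  have hu : IsUnit (n₂ : ZMod n₁) := (ZMod.isUnit_iff_coprime n₂ n₁).2 hcop.symm
  apply hu.mul_left_cancel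
  linear_combination f1 + (j : ZMod n₁) * f2
end

section
/- Let n be a positive integer, S ⊆ ℤ_n \ {0} with S = -S, and suppose Circ(n;S) is connected (i.e. ⟨S⟩ = ℤ_n). Let α be a graph automorphism of Circ(n;S) that respects the partition 𝒞 and fixes the vertex 0. Then there exists a group automorphism β of ℤ_n with β(S) = S such that the composition β∘α fixes the vertex a·s for every integer a and every s ∈ S. -/
lemma gcd_lcm_dvd' (a b c : ℕ) (ha : a ≠ 0) (hb : b ≠ 0) (hc : c ≠ 0) :
    Nat.gcd (Nat.lcm a b) c = Nat.lcm (Nat.gcd a c) (Nat.gcd b c) := by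
  have h1 : Nat.gcd a c ≠ 0 := Nat.gcd_ne_zero_left ha
  have h2 : Nat.gcd b c ≠ 0 := Nat.gcd_ne_zero_left hb
  have h3 : Nat.lcm a b ≠ 0 := Nat.lcm_ne_zero ha hb
  apply Nat.eq_of_factorization_eq (Nat.gcd_ne_zero_left h3) (Nat.lcm_ne_zero h1 h2)
  intro p
  rw [Nat.factorization_gcd h3 hc, Nat.factorization_lcm ha hb, Nat.factorization_lcm h1 h2,
    Nat.factorization_gcd ha hc, Nat.factorization_gcd hb hc]
  simp only [Finsupp.inf_apply, Finsupp.sup_apply]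
  exact inf_sup_right _ _ _

lemma crt_aux {ι : Type*} (T : Finset ι) (m : ι → ℕ) (hm : ∀ i, m i ≠ 0) (b : ℕ) (hb : b ≠ 0)
    (x y : ℕ) (h : ∀ i ∈ T, x ≡ y [MOD Nat.gcd (m i) b]) : x ≡ y [MOD Nat.gcd (T.lcm m) b] := by
  classical
  induction T using Finset.induction_on with
  | empty => simp [Nat.modEq_one]
  | insert i T hi ih =>
    rw [Finset.lcm_insert]
    change x ≡ y [MOD Nat.gcd (Nat.lcm (m i) (T.lcm m)) b]
    have hT : T.lcm m ≠ 0 := by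
      rw [Ne, Finset.lcm_eq_zero_iff]
      simp [hm]
    rw [gcd_lcm_dvd' _ _ _ (hm i) hT hb]
    have h1 := h i (by simp)
    have h2 := ih (fun j hj => h j (by simp [hj]))
    rw [Nat.modEq_iff_dvd] at *
    rw [Int.natCast_dvd] at *
    exact Nat.lcm_dvd h1 h2

lemma crt_gen {ι : Type*} (T : Finset ι) (m k : ι → ℕ) (hm : ∀ i, m i ≠ 0)
    (h : ∀ i ∈ T, ∀ j ∈ T, k i ≡ k j [MOD Nat.gcd (m i) (m j)]) :
    ∃ K : ℕ, ∀ i ∈ T, K ≡ k i [MOD m i] := by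
  classical
  induction T using Finset.induction_on with
  | empty => simp
  | insert j T hj ih =>
    obtain ⟨K, hK⟩ := ih (fun i hi i' hi' => h i (by simp [hi]) i' (by simp [hi']))
    have := crt_aux T m hm (m j) (hm j) K (k j) (fun i hi =>
      ((hK i hi).of_dvd (Nat.gcd_dvd_left _ _)).trans (h i (by simp [hi]) j (by simp)))
    obtain ⟨K', h1, h2⟩ := Nat.chineseRemainder' this
    refine ⟨K', fun i hi => ?_⟩
    rcases Finset.mem_insert.1 hi with rfl | hi
    · exact h2
    · exact (h1.of_dvd (Finset.dvd_lcm hi)).trans (hK i hi)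

lemma mem_zmult_of_dvd {n : ℕ} [NeZero n] (s u : ZMod n) (h : addOrderOf u ∣ addOrderOf s) :
    u ∈ AddSubgroup.zmultiples s := by
  classical
  have hpos : 0 < addOrderOf s := addOrderOf_pos s
  have hle := IsAddCyclic.card_nsmul_eq_zero_le (α := ZMod n) hpos
  have hsub : (AddSubgroup.zmultiples s : Set (ZMod n)).toFinset ⊆
      Finset.univ.filter (fun a : ZMod n => addOrderOf s • a = 0) := by
    intro a ha
    simp only [Set.mem_toFinset, SetLike.mem_coe] at ha
    simp only [Finset.mem_filter, Finset.mem_univ, true_and]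
    exact addOrderOf_dvd_iff_nsmul_eq_zero.1 (addOrderOf_dvd_of_mem_zmultiples ha)
  have hc : (AddSubgroup.zmultiples s : Set (ZMod n)).toFinset.card = addOrderOf s := by
    rw [Set.toFinset_card, ← Nat.card_eq_fintype_card]
    exact Nat.card_zmultiples s
  have := Finset.eq_of_subset_of_card_le hsub (by rw [hc]; exact hle)
  have hu : u ∈ Finset.univ.filter (fun a : ZMod n => addOrderOf s • a = 0) := by
    simp only [Finset.mem_filter, Finset.mem_univ, true_and]
    exact addOrderOf_dvd_iff_nsmul_eq_zero.1 h
  rw [← this] at hu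
  simpa using hu

/-- The key structural fact. -/
lemma alpha_line {n : ℕ} [NeZero n] (f : ZMod n → ZMod n) (hf : Function.Injective f)
    (hf0 : f 0 = 0) (s s' x' : ZMod n)
    (h : Sym2.map f '' cyclePart s 0 = cyclePart s' x') :
    addOrderOf (f s) = addOrderOf s ∧ ∀ a : ℕ, f (a • s) = a • f s := by
  have hedge : ∀ g ∈ AddSubgroup.zmultiples s, f g - x' ∈ AddSubgroup.zmultiples s' ∧
      (f (g + s) = f g + s' ∨ f (g + s) = f g - s') := by
    intro g hg
    have : s(f g, f (g + s)) ∈ cyclePart s' x' := by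
      rw [← h]
      exact ⟨s(g, g + s), ⟨g, by simpa using hg, rfl⟩, rfl⟩
    obtain ⟨g', hg', he⟩ := this
    rw [Sym2.eq_iff] at he
    rcases he with ⟨h1, h2⟩ | ⟨h1, h2⟩
    · rw [h1, h2]
      exact ⟨hg', Or.inl rfl⟩
    · rw [h1, h2]
      refine ⟨?_, Or.inr (by ring)⟩
      have := add_mem hg' (AddSubgroup.mem_zmultiples s')
      convert this using 1
      ring
  have hx' : x' ∈ AddSubgroup.zmultiples s' := by
    have := (hedge 0 (zero_mem _)).1
    rw [hf0] at this
    simpa using this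
  have himg : f '' (AddSubgroup.zmultiples s : Set (ZMod n)) = AddSubgroup.zmultiples s' := by
    ext y
    constructor
    · rintro ⟨g, hg, rfl⟩
      have := add_mem (hedge g hg).1 hx'
      simpa using this
    · intro hy
      have : s(y, y + s') ∈ cyclePart s' x' := ⟨y, sub_mem hy hx', rfl⟩
      rw [← h] at this
      obtain ⟨e, ⟨g, hg, rfl⟩, he⟩ := this
      rw [sub_zero] at hg
      rw [Sym2.map_mk, Sym2.eq_iff] at he
      rcases he with ⟨h1, h2⟩ | ⟨h1, h2⟩
      · exact ⟨g, hg, h1⟩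
      · exact ⟨g + s, add_mem hg (AddSubgroup.mem_zmultiples s), h2⟩
  have hord' : addOrderOf s' = addOrderOf s := by
    rw [← Nat.card_zmultiples s, ← Nat.card_zmultiples s']
    have := Nat.card_image_of_injective hf (AddSubgroup.zmultiples s : Set (ZMod n))
    rw [himg] at this
    exact this
  have ht : f s = s' ∨ f s = -s' := by
    have := (hedge 0 (zero_mem _)).2
    simpa [hf0] using this
  have hord : addOrderOf (f s) = addOrderOf s := by
    rcases ht with h1 | h1 <;> simp [h1, hord']
  have hstep : ∀ g ∈ AddSubgroup.zmultiples s, f (g + s) = f g + f s ∨ f (g + s) = f g - f s := by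
    intro g hg
    rcases ht with h1 | h1 <;> rw [h1]
    · exact (hedge g hg).2
    · rw [sub_neg_eq_add, ← sub_eq_add_neg]
      exact (hedge g hg).2.symm
  refine ⟨hord, ?_⟩
  have key : ∀ a : ℕ, f (a • s) = a • f s ∧ f ((a + 1) • s) = (a + 1) • f s := by
    intro a
    induction a with
    | zero => simp [hf0]
    | succ a ih =>
      refine ⟨ih.2, ?_⟩
      have hmem : (a + 1) • s ∈ AddSubgroup.zmultiples s :=
        nsmul_mem (AddSubgroup.mem_zmultiples s) _
      rw [succ_nsmul s (a + 1), succ_nsmul (f s) (a + 1), ← ih.2]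
      rcases hstep _ hmem with h1 | h1
      · exact h1
      · have h2 : f ((a + 1) • s + s) = f (a • s) := by
          rw [h1, ih.2, ih.1, succ_nsmul]; ring
        have h3 := hf h2
        have h4 : 2 • s = 0 := by
          rw [succ_nsmul, add_assoc] at h3
          rw [two_nsmul]
          simpa using h3
        have h5 : 2 • f s = 0 := by
          rw [← addOrderOf_dvd_iff_nsmul_eq_zero] at h4 ⊢
          rwa [hord]
        rw [h1, sub_eq_add_neg, neg_eq_of_add_eq_zero_left (by rw [← two_nsmul]; exact h5)]
  exact fun a => (key a).1

theorem lemma_j (n : ℕ) (hn : 0 < n) (S : Set (ZMod n))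
    (h0S : (0 : ZMod n) ∉ S) (hSsym : S = -S)
    (hconn : AddSubgroup.closure S = ⊤)
    (α : Circ n S ≃g Circ n S) (hα0 : α 0 = 0) (hC : RespectsC S ⇑α) :
    ∃ β : ZMod n ≃+ ZMod n, (⇑β '' S = S) ∧
      ∀ (a : ℤ), ∀ s ∈ S, β (α (a • s)) = a • s := by
  classical
  haveI : NeZero n := ⟨hn.ne'⟩
  have hline : ∀ s ∈ S, addOrderOf (α s) = addOrderOf s ∧ ∀ a : ℕ, α (a • s) = a • α s := by
    intro s hs
    obtain ⟨s', -, x', h⟩ := hC s hs 0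
    exact alpha_line α α.injective hα0 s s' x' h
  have hadj : ∀ s, (Circ n S).Adj 0 s ↔ s ∈ S := by
    intro s
    have hneg : -s ∈ S ↔ s ∈ S := by
      conv_rhs => rw [hSsym]
      exact Set.mem_neg.symm
    simp only [Circ, SimpleGraph.fromRel_adj, sub_zero, zero_sub, hneg, or_self]
    exact ⟨fun h => h.2, fun h => ⟨fun h' => h0S (h' ▸ h), h⟩⟩
  have hαS : ∀ s, α s ∈ S ↔ s ∈ S := by
    intro s
    have h := α.map_adj_iff (v := 0) (w := s)
    rwa [hα0, hadj, hadj] at h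
  have hex : ∀ s, ∃ k : ℕ, s ∈ S → k • s = α s := by
    intro s
    by_cases hs : s ∈ S
    · have := mem_zmult_of_dvd s (α s) (by rw [(hline s hs).1])
      rw [← mem_multiples_iff_mem_zmultiples] at this
      obtain ⟨k, hk⟩ := this
      exact ⟨k, fun _ => hk⟩
    · exact ⟨0, fun h => absurd h hs⟩
  choose k hk using hex
  obtain ⟨K, hK⟩ := crt_gen (S.toFinset) (fun s => addOrderOf s) k
    (fun s => (addOrderOf_pos s).ne') (by
      intro s hs t ht
      rw [Set.mem_toFinset] at hs ht
      set d := Nat.gcd (addOrderOf s) (addOrderOf t) with hd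
      have hdpos : 0 < d := Nat.gcd_pos_of_pos_left _ (addOrderOf_pos s)
      obtain ⟨c, hc⟩ : d ∣ addOrderOf s := Nat.gcd_dvd_left _ _
      have hcpos : c ≠ 0 := by
        rintro rfl
        exact (addOrderOf_pos s).ne' (by simpa using hc)
      have hu : addOrderOf (c • s) = d := by
        rw [addOrderOf_nsmul_of_dvd hcpos ⟨d, by rw [hc, mul_comm]⟩, hc,
          Nat.mul_div_cancel _ (Nat.pos_of_ne_zero hcpos)]
      have hut : c • s ∈ AddSubgroup.zmultiples t :=
        mem_zmult_of_dvd _ _ (by rw [hu]; exact Nat.gcd_dvd_right _ _)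
      rw [← mem_multiples_iff_mem_zmultiples] at hut
      obtain ⟨e, he⟩ := hut
      simp only at he
      have h1 : α (c • s) = k s • (c • s) := by
        rw [(hline s hs).2, ← hk s hs, smul_comm]
      have h2 : α (c • s) = k t • (c • s) := by
        rw [← he, (hline t ht).2, ← hk t ht, smul_comm]
      rw [h1, nsmul_eq_nsmul_iff_modEq, hu] at h2
      exact h2)
  have hKs : ∀ s ∈ S, K • s = α s := by
    intro s hs
    rw [← hk s hs, nsmul_eq_nsmul_iff_modEq]
    exact hK s (by simpa using hs)
  let φ : ZMod n →+ ZMod n := nsmulAddMonoidHom K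
  have hφ : ∀ x, φ x = K • x := fun x => rfl
  have himg : φ '' S = S := by
    ext y
    constructor
    · rintro ⟨s, hs, rfl⟩
      rw [hφ, hKs s hs]
      exact (hαS s).2 hs
    · intro hy
      have hs : α.symm y ∈ S := (hαS _).1 (by simpa using hy)
      exact ⟨α.symm y, hs, by rw [hφ, hKs _ hs]; simp⟩
  have hsurj : Function.Surjective φ := by
    rw [← AddMonoidHom.range_eq_top, eq_top_iff, ← hconn, AddSubgroup.closure_le]
    intro y hy
    rw [← himg] at hy
    obtain ⟨s, -, rfl⟩ := hy
    exact ⟨s, rfl⟩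
  have hbij : Function.Bijective φ := ⟨Finite.injective_iff_surjective.2 hsurj, hsurj⟩
  let γ := AddEquiv.ofBijective φ hbij
  have hγ : ∀ x, γ x = K • x := fun x => rfl
  refine ⟨γ.symm, ?_, ?_⟩
  · have : S = γ '' S := himg.symm
    conv_lhs => rw [this]
    rw [← Set.image_comp]
    simp
  · intro a s hs
    rw [AddEquiv.symm_apply_eq, hγ]
    have hmem : a • s ∈ AddSubgroup.zmultiples s := ⟨a, rfl⟩
    rw [← mem_multiples_iff_mem_zmultiples] at hmem
    obtain ⟨b, hb⟩ := hmem
    simp only at hb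
    rw [← hb, (hline s hs).2, ← hKs s hs, smul_comm]
end

section
/- Let n be a positive integer, S ⊆ ℤ_n \ {0} with S = -S, and let α be a graph automorphism of Circ(n;S) that respects the partition 𝒞. Let S' ⊆ S and let G = ⟨S'⟩ be the subgroup of ℤ_n generated by S'. Then for every x ∈ ℤ_n, the image α(x + G) of the coset x + G under α is again a coset of G in ℤ_n. -/
theorem aux_card_le {n : ℕ} [NeZero n] (H : AddSubgroup (ZMod n)) :
    (H : Set (ZMod n)) = {a : ZMod n | Nat.card H • a = 0} := by
  classical
  apply Set.eq_of_subset_of_ncard_le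
  · intro a ha
    have := card_nsmul_eq_zero' (x := (⟨a, ha⟩ : H))
    exact congrArg Subtype.val this
  · have h := IsAddCyclic.card_nsmul_eq_zero_le (α := ZMod n) (n := Nat.card H) Nat.card_pos
    rw [Set.ncard_eq_toFinset_card']
    refine le_trans ?_ (h.trans ?_)
    · apply le_of_eq
      congr 1
      ext; simp
    · exact le_of_eq (Nat.card_coe_set_eq _)
  · exact Set.toFinite _

theorem aux_eq {n : ℕ} [NeZero n] (H K : AddSubgroup (ZMod n)) (h : Nat.card H = Nat.card K) :
    H = K := by
  apply SetLike.coe_injective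
  rw [aux_card_le H, aux_card_le K, h]

theorem aux_verts {n : ℕ} (s x v : ZMod n) :
    v - x ∈ AddSubgroup.zmultiples s ↔ ∃ e ∈ cyclePart s x, v ∈ e := by
  constructor
  · intro h
    exact ⟨s(v, v + s), ⟨v, h, rfl⟩, by simp⟩
  · rintro ⟨e, ⟨g, hg, rfl⟩, hv⟩
    rcases Sym2.mem_iff.1 hv with rfl | rfl
    · exact hg
    · have := add_mem hg (AddSubgroup.mem_zmultiples s)
      rwa [show g + s - x = g - x + s by ring]

theorem aux_coset_card {n : ℕ} (H : AddSubgroup (ZMod n)) (x : ZMod n) :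
    {z : ZMod n | z - x ∈ H}.ncard = Nat.card H := by
  have : {z : ZMod n | z - x ∈ H} = (fun z => z + x) '' (H : Set (ZMod n)) := by
    ext z
    simp [sub_eq_add_neg]
  rw [this, Set.ncard_image_of_injective _ (add_left_injective x)]
  exact (Nat.card_coe_set_eq _).symm

theorem aux_step {n : ℕ} [NeZero n] (S : Set (ZMod n)) (f : ZMod n → ZMod n)
    (hf : Function.Injective f) (hC : RespectsC S f) (s : ZMod n) (hs : s ∈ S) (x : ZMod n) :
    f (x + s) - f x ∈ AddSubgroup.zmultiples s := by
  obtain ⟨s', hs', x', h⟩ := hC s hs x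
  have him : f '' {z | z - x ∈ AddSubgroup.zmultiples s}
      = {z | z - x' ∈ AddSubgroup.zmultiples s'} := by
    ext w
    simp only [Set.mem_image, Set.mem_setOf_eq, aux_verts, ← h]
    constructor
    · rintro ⟨v, ⟨e, he, hv⟩, rfl⟩
      exact ⟨_, ⟨e, he, rfl⟩, Sym2.mem_map.2 ⟨v, hv, rfl⟩⟩
    · rintro ⟨_, ⟨e, he, rfl⟩, hw⟩
      obtain ⟨v, hv, rfl⟩ := Sym2.mem_map.1 hw
      exact ⟨v, ⟨e, he, hv⟩, rfl⟩
  have hc := congrArg Set.ncard him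
  rw [Set.ncard_image_of_injective _ hf, aux_coset_card, aux_coset_card] at hc
  rw [← aux_eq _ _ hc] at him
  have h1 : f (x + s) ∈ f '' {z | z - x ∈ AddSubgroup.zmultiples s} :=
    ⟨x + s, by simp, rfl⟩
  have h2 : f x ∈ f '' {z | z - x ∈ AddSubgroup.zmultiples s} :=
    ⟨x, by simp, rfl⟩
  rw [him] at h1 h2
  have h1' : f (x + s) - x' ∈ AddSubgroup.zmultiples s := h1
  have h2' : f x - x' ∈ AddSubgroup.zmultiples s := h2
  have := sub_mem h1' h2'
  rwa [sub_sub_sub_cancel_right] at this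

theorem lemma_cosets (n : ℕ) (hn : 0 < n) (S : Set (ZMod n))
    (h0S : (0 : ZMod n) ∉ S) (hSsym : S = -S)
    (α : Circ n S ≃g Circ n S) (hC : RespectsC S ⇑α)
    (S' : Set (ZMod n)) (hS' : S' ⊆ S)
    (G : AddSubgroup (ZMod n)) (hG : G = AddSubgroup.closure S') :
    ∀ x : ZMod n, ∃ y : ZMod n,
      ⇑α '' {z : ZMod n | z - x ∈ G} = {z : ZMod n | z - y ∈ G} := by
  haveI : NeZero n := ⟨hn.ne'⟩
  have hinj : Function.Injective ⇑α := α.injective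
  have key : ∀ g ∈ AddSubgroup.closure S', ∀ x, α (x + g) - α x ∈ G := by
    intro g hg
    induction hg using AddSubgroup.closure_induction with
    | mem s hs =>
      intro x
      have h := aux_step S α hinj hC s (hS' hs) x
      refine (AddSubgroup.zmultiples_le_of_mem ?_) h
      rw [hG]
      exact AddSubgroup.subset_closure hs
    | zero => intro x; simp
    | add a b _ _ iha ihb =>
      intro x
      have := add_mem (ihb (x + a)) (iha x)
      rwa [sub_add_sub_cancel, add_assoc] at this
    | neg a _ iha =>
      intro x
      have := neg_mem (iha (x + -a))
      rwa [neg_sub, neg_add_cancel_right] at this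
  intro x
  refine ⟨α x, ?_⟩
  apply Set.eq_of_subset_of_ncard_le
  · rintro _ ⟨z, hz, rfl⟩
    have hz' : z - x ∈ AddSubgroup.closure S' := hG ▸ hz
    have := key _ hz' x
    rwa [add_sub_cancel] at this
  · rw [Set.ncard_image_of_injective _ hinj, aux_coset_card, aux_coset_card]
  · exact Set.toFinite _
end

section
/- Let n be a positive integer, S ⊆ ℤ_n \ {0} with S = -S, and let α be a graph automorphism of Circ(n;S) that respects the partition 𝒞. Let S' ⊆ S, let G = ⟨S'⟩ be the subgroup of ℤ_n generated by S' with |G| = n', let s ∈ S have order r in ℤ_n, let d = gcd(n', r), and let G' = ⟨G ∪ {s}⟩. Suppose α fixes every vertex of a set T, where G ⊆ T ⊆ G' and T is a union of cosets of the subgroup ⟨n/d⟩ of ℤ_n. If x, x+s', and x+s all lie in T for some s' ∈ S', then α fixes the vertex x+s+s'. -/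
lemma aux_mem_zmult {n : ℕ} [NeZero n] (d : ℕ) (hd : d ∣ n) (z : ZMod n) (hz : d • z = 0) :
    z ∈ AddSubgroup.zmultiples (((n / d : ℕ) : ZMod n)) := by
  obtain ⟨m, rfl⟩ := hd
  have hn : d * m ≠ 0 := NeZero.ne _
  have hd0 : 0 < d := Nat.pos_of_ne_zero (by rintro rfl; simp at hn)
  rw [Nat.mul_div_cancel_left _ hd0]
  have h1 : ((d * z.val : ℕ) : ZMod (d * m)) = 0 := by
    rw [Nat.cast_mul, ZMod.natCast_zmod_val, ← nsmul_eq_mul, hz]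
  rw [ZMod.natCast_eq_zero_iff] at h1
  obtain ⟨k, hk⟩ := Nat.dvd_of_mul_dvd_mul_left hd0 h1
  refine AddSubgroup.mem_zmultiples_iff.2 ⟨k, ?_⟩
  rw [← ZMod.natCast_zmod_val z, hk]
  simp [mul_comm]

lemma aux_mem_order {n : ℕ} [NeZero n] (u z : ZMod n) (hz : addOrderOf u • z = 0) :
    z ∈ AddSubgroup.zmultiples u := by
  have hd : addOrderOf u ∣ n := by
    simpa using addOrderOf_dvd_natCard (x := u)
  have h1 := aux_mem_zmult _ hd z hz
  have h2 := aux_mem_zmult _ hd u (addOrderOf_nsmul_eq_zero u)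
  have hle : AddSubgroup.zmultiples u ≤
      AddSubgroup.zmultiples (((n / addOrderOf u : ℕ) : ZMod n)) := by
    simpa using h2
  have hle2 : addOrderOf (((n / addOrderOf u : ℕ) : ZMod n)) ≤ addOrderOf u := by
    apply addOrderOf_le_of_nsmul_eq_zero (addOrderOf_pos u)
    rw [nsmul_eq_mul, ← Nat.cast_mul, Nat.mul_div_cancel' hd]
    simp
  have heq := AddSubgroup.eq_of_le_of_card_ge hle
    (by rw [Nat.card_zmultiples, Nat.card_zmultiples]; exact hle2)
  rw [heq]; exact h1

lemma aux_cycle {n : ℕ} [NeZero n] (S : Set (ZMod n)) (f : ZMod n → ZMod n)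
    (hinj : Function.Injective f) (hC : RespectsC S f) (s : ZMod n) (hs : s ∈ S) (p : ZMod n)
    (hp : f p = p) :
    ∃ b : ZMod n, ∀ k : ℕ, f (p + k • s) = p + k • b := by
  obtain ⟨s1, -, x1, him⟩ := hC s hs p
  have hverts : f '' {g | g - p ∈ AddSubgroup.zmultiples s} =
      {g | g - x1 ∈ AddSubgroup.zmultiples s1} := by
    ext v
    constructor
    · rintro ⟨g, hg, rfl⟩
      have : Sym2.map f s(g, g + s) ∈ cyclePart s1 x1 := by
        rw [← him]; exact ⟨_, ⟨g, hg, rfl⟩, rfl⟩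
      obtain ⟨g1, hg1, he⟩ := this
      rw [Sym2.map_mk, Sym2.eq_iff] at he
      rcases he with ⟨h, -⟩ | ⟨h, -⟩
      · rw [h]; exact hg1
      · rw [h]
        have := add_mem hg1 (AddSubgroup.mem_zmultiples s1)
        simpa [sub_add_eq_add_sub] using this
    · intro hv
      have : s(v, v + s1) ∈ Sym2.map f '' cyclePart s p := by
        rw [him]; exact ⟨v, hv, rfl⟩
      obtain ⟨_, ⟨g, hg, rfl⟩, he⟩ := this
      rw [Sym2.map_mk, Sym2.eq_iff] at he
      rcases he with ⟨h, -⟩ | ⟨-, h⟩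
      · exact ⟨g, hg, h⟩
      · refine ⟨g + s, ?_, h⟩
        have := add_mem hg (AddSubgroup.mem_zmultiples s)
        simpa [sub_add_eq_add_sub] using this
  have hcard : ∀ (x u : ZMod n),
      Set.ncard {g | g - x ∈ AddSubgroup.zmultiples u} = addOrderOf u := by
    intro x u
    rw [← Nat.card_zmultiples]
    have : {g | g - x ∈ AddSubgroup.zmultiples u} =
        (fun g => g + x) '' (AddSubgroup.zmultiples u : Set (ZMod n)) := by
      ext g
      constructor
      · intro h; exact ⟨g - x, h, by simp⟩
      · rintro ⟨w, hw, rfl⟩; simpa using hw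
    rw [this, Set.ncard_image_of_injective _ (add_left_injective x)]
    rfl
  have hord : addOrderOf s = addOrderOf s1 := by
    rw [← hcard p s, ← hcard x1 s1, ← hverts, Set.ncard_image_of_injective _ hinj]
  have hstep : ∀ k : ℕ, f (p + (k + 1) • s) = f (p + k • s) + s1 ∨
      f (p + (k + 1) • s) = f (p + k • s) - s1 := by
    intro k
    have : Sym2.map f s(p + k • s, p + k • s + s) ∈ cyclePart s1 x1 := by
      rw [← him]
      exact ⟨_, ⟨p + k • s, by rw [add_sub_cancel_left]; exact AddSubgroup.nsmul_mem_zmultiples s k, rfl⟩, rfl⟩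
    obtain ⟨g1, hg1, he⟩ := this
    rw [Sym2.map_mk, Sym2.eq_iff] at he
    rw [succ_nsmul, ← add_assoc]
    rcases he with ⟨h, h'⟩ | ⟨h, h'⟩
    · left; rw [h, h']
    · right; rw [h, h']; simp
  have h2 : 2 • s = 0 → 2 • s1 = 0 := by
    intro h
    rw [← addOrderOf_dvd_iff_nsmul_eq_zero] at h ⊢
    rwa [← hord]
  have main : ∀ b, (b = s1 ∨ b = -s1) → f (p + s) = p + b →
      ∀ k : ℕ, f (p + k • s) = p + k • b ∧ f (p + (k + 1) • s) = p + (k + 1) • b := by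
    intro b hb hfb k
    induction k with
    | zero => simpa [hp] using hfb
    | succ k ih =>
      refine ⟨ih.2, ?_⟩
      have hst : f (p + (k + 1 + 1) • s) = f (p + (k + 1) • s) + b ∨
          f (p + (k + 1 + 1) • s) = f (p + (k + 1) • s) - b := by
        rcases hb with rfl | rfl
        · exact hstep (k + 1)
        · have := hstep (k + 1)
          rw [sub_neg_eq_add, ← sub_eq_add_neg]
          exact this.symm
      rcases hst with h | h
      · rw [h, ih.2, succ_nsmul b (k + 1), add_assoc]
      · have h3 : f (p + (k + 1 + 1) • s) = f (p + k • s) := by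
          rw [h, ih.1, ih.2, succ_nsmul b k]; abel
        have h4 : 2 • s = 0 := by
          have := hinj h3
          have h5 : p + k • s + 2 • s = p + k • s + 0 := by
            rw [add_zero, add_assoc, ← add_nsmul]; exact this
          exact add_left_cancel h5
        have h5 : 2 • b = 0 := by
          rcases hb with rfl | rfl
          · exact h2 h4
          · rw [smul_neg, h2 h4, neg_zero]
        rw [h3, ih.1, show k + 1 + 1 = k + 2 from rfl, add_nsmul, h5, add_zero]
  have h0 := hstep 0
  simp only [zero_add, one_nsmul, zero_nsmul, add_zero, hp] at h0
  rcases h0 with h | h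
  · exact ⟨s1, fun k => (main s1 (Or.inl rfl) h k).1⟩
  · exact ⟨-s1, fun k => (main (-s1) (Or.inr rfl) (by rw [h, sub_eq_add_neg]) k).1⟩


theorem lemma_4cycles (n : ℕ) (hn : 0 < n) (S : Set (ZMod n))
    (h0S : (0 : ZMod n) ∉ S) (hSsym : S = -S)
    (α : Circ n S ≃g Circ n S) (hC : RespectsC S ⇑α)
    (S' : Set (ZMod n)) (hS'S : S' ⊆ S)
    (G : AddSubgroup (ZMod n)) (hG : G = AddSubgroup.closure S')
    (n' : ℕ) (hn' : n' = Nat.card G)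
    (s : ZMod n) (hs : s ∈ S)
    (r : ℕ) (hr : r = addOrderOf s)
    (d : ℕ) (hd : d = Nat.gcd n' r)
    (G' : AddSubgroup (ZMod n)) (hG' : G' = AddSubgroup.closure (↑G ∪ {s}))
    (T : Set (ZMod n)) (hGT : ↑G ⊆ T) (hTG' : T ⊆ ↑G')
    (hTcosets : ∀ t ∈ T, ∀ z ∈ AddSubgroup.zmultiples (((n / d : ℕ) : ZMod n)), t + z ∈ T)
    (hfix : ∀ t ∈ T, α t = t)
    (x s' : ZMod n) (hs' : s' ∈ S')
    (hx : x ∈ T) (hxs' : x + s' ∈ T) (hxs : x + s ∈ T) :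
    α (x + s + s') = x + s + s' := by
  haveI : NeZero n := ⟨hn.ne'⟩
  have hs'G : s' ∈ G := by rw [hG]; exact AddSubgroup.subset_closure hs'
  have hdn : d ∣ n := by
    rw [hd, hr]
    refine (Nat.gcd_dvd_right _ _).trans ?_
    simpa using addOrderOf_dvd_natCard (x := s)
  have hE : ∀ t ∈ T, ∀ z : ZMod n, z ∈ AddSubgroup.zmultiples s →
      z ∈ AddSubgroup.zmultiples s' → t + z ∈ T := by
    intro t ht z hz hz'
    apply hTcosets t ht
    apply aux_mem_zmult d hdn
    rw [← addOrderOf_dvd_iff_nsmul_eq_zero, hd]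
    apply Nat.dvd_gcd
    · rw [hn']
      have hzG : z ∈ G := (AddSubgroup.zmultiples_le_of_mem hs'G) hz'
      exact AddSubgroup.addOrderOf_dvd_natCard G hzG
    · rw [hr]
      exact addOrderOf_dvd_of_mem_zmultiples hz
  obtain ⟨b, hb⟩ := aux_cycle S α α.injective hC s hs (x + s') (hfix _ hxs')
  obtain ⟨a, ha⟩ := aux_cycle S α α.injective hC s' (hS'S hs') (x + s) (hfix _ hxs)
  set r' := addOrderOf s' with hr'
  have hr0 : 0 < r := hr ▸ addOrderOf_pos s
  set e := Nat.gcd r r' with he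
  have he0 : 0 < e := Nat.gcd_pos_of_pos_left _ hr0
  have her : e ∣ r := Nat.gcd_dvd_left _ _
  have her' : e ∣ r' := Nat.gcd_dvd_right _ _
  have hrs : r • s = 0 := by rw [hr]; exact addOrderOf_nsmul_eq_zero s
  have hrs' : r' • s' = 0 := addOrderOf_nsmul_eq_zero s'
  have k1 : (r / e) • s ∈ AddSubgroup.zmultiples s' := by
    apply aux_mem_order
    rw [← hr', ← mul_nsmul', ← Nat.mul_div_assoc _ her, mul_comm, Nat.mul_div_assoc _ her',
      mul_comm, mul_nsmul', hrs, smul_zero]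
  have k2 : (r' / e) • s' ∈ AddSubgroup.zmultiples s := by
    apply aux_mem_order
    rw [← hr, ← mul_nsmul', ← Nat.mul_div_assoc _ her', mul_comm, Nat.mul_div_assoc _ her,
      mul_comm, mul_nsmul', hrs', smul_zero]
  have e1 : (r / e) • (b - s) = 0 := by
    have h := hb (r / e)
    rw [hfix _ (hE _ hxs' _ (AddSubgroup.nsmul_mem_zmultiples s _) k1)] at h
    rw [nsmul_sub, sub_eq_zero]
    exact (add_left_cancel h).symm
  have e2 : (r' / e) • (a - s') = 0 := by
    have h := ha (r' / e)
    rw [hfix _ (hE _ hxs _ k2 (AddSubgroup.nsmul_mem_zmultiples s' _))] at h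
    rw [nsmul_sub, sub_eq_zero]
    exact (add_left_cancel h).symm
  have hb1 := hb 1
  have ha1 := ha 1
  rw [one_nsmul, one_nsmul] at hb1 ha1
  have hab : b - s = a - s' := by
    rw [show x + s' + s = x + s + s' by abel, ha1] at hb1
    linear_combination -hb1
  rw [← hab] at e2
  have hcop : Nat.Coprime (r / e) (r' / e) := Nat.coprime_div_gcd_div_gcd he0
  have h1 : addOrderOf (b - s) ∣ 1 := by
    rw [← hcop.gcd_eq_one]
    exact Nat.dvd_gcd (addOrderOf_dvd_of_nsmul_eq_zero e1) (addOrderOf_dvd_of_nsmul_eq_zero e2)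
  have h0 : b - s = 0 := by
    rw [addOrderOf_dvd_iff_nsmul_eq_zero, one_nsmul] at h1; exact h1
  rw [ha1]
  rw [h0] at hab
  rw [sub_eq_zero.1 hab.symm]
end

section
/- Let n be a positive integer, S ⊆ ℤ_n \ {0} with S = -S, and let α be a graph automorphism of Circ(n;S) that respects the partition 𝒞. Let S' ⊆ S, let G = ⟨S'⟩ be the subgroup of ℤ_n generated by S' with |G| = n', let s ∈ S have order r in ℤ_n, let d = gcd(n', r), and let G' = ⟨G ∪ {s}⟩. If α fixes every element of G pointwise and every element of ⟨s⟩ pointwise, then every coset of the subgroup ⟨n/d⟩ of ℤ_n that is contained in G' is fixed setwise by α. -/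
lemma verts_cyclePart {n : ℕ} (s x : ZMod n) :
    {v | ∃ e ∈ cyclePart s x, v ∈ e} = {z | z - x ∈ AddSubgroup.zmultiples s} := by
  ext v
  simp only [Set.mem_ofPred_eq, cyclePart]
  constructor
  · rintro ⟨e, ⟨g, hg, rfl⟩, hv⟩
    rcases Sym2.mem_iff.1 hv with rfl | rfl
    · exact hg
    · have := add_mem hg (AddSubgroup.mem_zmultiples s)
      rwa [show g + s - x = g - x + s by ring]
  · intro hv
    exact ⟨s(v, v + s), ⟨v, hv, rfl⟩, Sym2.mem_mk_left _ _⟩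

lemma ncard_coset_aux {n : ℕ} (H : AddSubgroup (ZMod n)) (x : ZMod n) :
    {z | z - x ∈ H}.ncard = Nat.card H := by
  have : {z | z - x ∈ H} = (fun z => z + x) '' (H : Set (ZMod n)) := by
    ext z
    simp only [Set.mem_ofPred_eq, Set.mem_image, SetLike.mem_coe]
    constructor
    · intro h
      exact ⟨z - x, h, by ring⟩
    · rintro ⟨w, hw, rfl⟩
      simpa using hw
  rw [this, Set.ncard_image_of_injective _ (add_left_injective x)]
  rfl

lemma inter_aux {n : ℕ} (hn : 0 < n) (d : ℕ) (hd : d ∣ n) (w : ZMod n) (hw : d • w = 0) :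
    w ∈ AddSubgroup.zmultiples (((n / d : ℕ) : ZMod n)) := by
  have : NeZero n := ⟨hn.ne'⟩
  obtain ⟨m, rfl⟩ := hd
  have hd0 : 0 < d := Nat.pos_of_mul_pos_right hn
  rw [Nat.mul_div_cancel_left _ hd0]
  rw [← ZMod.natCast_zmod_val w, nsmul_eq_mul, ← Nat.cast_mul, ZMod.natCast_eq_zero_iff] at hw
  obtain ⟨k, hk⟩ := Nat.dvd_of_mul_dvd_mul_left hd0 hw
  rw [← ZMod.natCast_zmod_val w, hk, mul_comm m k, Nat.cast_mul, ← nsmul_eq_mul]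
  exact nsmul_mem (AddSubgroup.mem_zmultiples (m : ZMod (d * m))) k

lemma card_aux {n : ℕ} (hn : 0 < n) (t : ZMod n) (d : ℕ)
    (hd : d = Nat.card (AddSubgroup.zmultiples t)) :
    AddSubgroup.zmultiples t = AddSubgroup.zmultiples (((n / d : ℕ) : ZMod n)) := by
  have : NeZero n := ⟨hn.ne'⟩
  have hdn : d ∣ n := by
    rw [hd]
    simpa only [Nat.card_zmod] using
      AddSubgroup.card_addSubgroup_dvd_card (AddSubgroup.zmultiples t)
  have hd0 : 0 < d := Nat.pos_of_dvd_of_pos hdn hn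
  apply AddSubgroup.eq_of_le_of_card_ge
  · apply AddSubgroup.zmultiples_le_of_mem
    apply inter_aux hn d hdn
    rw [hd, Nat.card_zmultiples, addOrderOf_nsmul_eq_zero]
  · rw [← hd, Nat.card_zmultiples]
    apply addOrderOf_le_of_nsmul_eq_zero hd0
    rw [nsmul_eq_mul, ← Nat.cast_mul, Nat.mul_div_cancel' hdn, ZMod.natCast_self]

lemma step_aux {n : ℕ} (hn : 0 < n) (S : Set (ZMod n)) (f : ZMod n → ZMod n)
    (hf : Function.Injective f) (hC : RespectsC S f) (t : ZMod n) (ht : t ∈ S)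
    (y z : ZMod n) (h : z - y ∈ AddSubgroup.zmultiples t) :
    f z - f y ∈ AddSubgroup.zmultiples t := by
  have : NeZero n := ⟨hn.ne'⟩
  obtain ⟨s', hs', x', hx⟩ := hC t ht y
  have him : f '' {z | z - y ∈ AddSubgroup.zmultiples t}
      = {z | z - x' ∈ AddSubgroup.zmultiples s'} := by
    rw [← verts_cyclePart, ← verts_cyclePart, ← hx]
    ext v
    simp only [Set.mem_image, Set.mem_ofPred_eq]
    constructor
    · rintro ⟨w, ⟨e, he, hw⟩, rfl⟩
      exact ⟨_, ⟨e, he, rfl⟩, Sym2.mem_map.2 ⟨w, hw, rfl⟩⟩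
    · rintro ⟨_, ⟨e, he, rfl⟩, hv⟩
      obtain ⟨w, hw, rfl⟩ := Sym2.mem_map.1 hv
      exact ⟨w, ⟨e, he, hw⟩, rfl⟩
  have hcard : Nat.card (AddSubgroup.zmultiples t) = Nat.card (AddSubgroup.zmultiples s') := by
    rw [← ncard_coset_aux _ y, ← ncard_coset_aux _ x', ← him, Set.ncard_image_of_injective _ hf]
  have heq : AddSubgroup.zmultiples t = AddSubgroup.zmultiples s' :=
    (card_aux hn t _ rfl).trans (by rw [hcard, ← card_aux hn s' _ rfl])
  have h1 : f z - x' ∈ AddSubgroup.zmultiples s' := by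
    change f z ∈ {z | z - x' ∈ AddSubgroup.zmultiples s'}
    exact him ▸ ⟨z, h, rfl⟩
  have h2 : f y - x' ∈ AddSubgroup.zmultiples s' := by
    change f y ∈ {z | z - x' ∈ AddSubgroup.zmultiples s'}
    exact
      him ▸ ⟨y, by simp, rfl⟩
  rw [heq]
  have := sub_mem h1 h2
  simpa using this

lemma closure_aux {n : ℕ} (hn : 0 < n) (S : Set (ZMod n)) (f : ZMod n → ZMod n)
    (hf : Function.Injective f) (hC : RespectsC S f) (T : Set (ZMod n)) (hT : T ⊆ S)
    (w : ZMod n) (hw : w ∈ AddSubgroup.closure T) :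
    ∀ y, f (y + w) - f y ∈ AddSubgroup.closure T := by
  induction hw using AddSubgroup.closure_induction with
  | mem t ht =>
    intro y
    have h := step_aux hn S f hf hC t (hT ht) y (y + t) (by simp)
    exact (AddSubgroup.zmultiples_le_of_mem (AddSubgroup.subset_closure ht)) h
  | zero => intro y; simp
  | add a b _ _ iha ihb =>
    intro y
    have := add_mem (ihb (y + a)) (iha y)
    rw [← add_assoc]
    simpa using this
  | neg a _ iha =>
    intro y
    have := neg_mem (iha (y + -a))
    simpa using this

theorem cosets_fixed_setwise (n : ℕ) (hn : 0 < n) (S : Set (ZMod n))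
    (h0S : (0 : ZMod n) ∉ S) (hSsym : S = -S)
    (α : Circ n S ≃g Circ n S) (hC : RespectsC S ⇑α)
    (S' : Set (ZMod n)) (hS'S : S' ⊆ S)
    (G : AddSubgroup (ZMod n)) (hG : G = AddSubgroup.closure S')
    (n' : ℕ) (hn' : n' = Nat.card G)
    (s : ZMod n) (hs : s ∈ S)
    (r : ℕ) (hr : r = addOrderOf s)
    (d : ℕ) (hd : d = Nat.gcd n' r)
    (G' : AddSubgroup (ZMod n)) (hG' : G' = AddSubgroup.closure (↑G ∪ {s}))
    (hfixG : ∀ g ∈ G, α g = g)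
    (hfixs : ∀ g ∈ AddSubgroup.zmultiples s, α g = g) :
    ∀ x : ZMod n,
      {z : ZMod n | z - x ∈ AddSubgroup.zmultiples (((n / d : ℕ) : ZMod n))} ⊆ ↑G' →
      ⇑α '' {z : ZMod n | z - x ∈ AddSubgroup.zmultiples (((n / d : ℕ) : ZMod n))}
        = {z : ZMod n | z - x ∈ AddSubgroup.zmultiples (((n / d : ℕ) : ZMod n))} := by
  have : NeZero n := ⟨hn.ne'⟩
  have hinj : Function.Injective (⇑α) := α.injective
  have hdn : d ∣ n := by
    rw [hd]
    refine (Nat.gcd_dvd_left _ _).trans ?_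
    rw [hn']
    simpa using AddSubgroup.card_addSubgroup_dvd_card G
  have key : ∀ z ∈ G', α z - z ∈ AddSubgroup.zmultiples (((n / d : ℕ) : ZMod n)) := by
    intro z hz
    rw [hG', AddSubgroup.closure_union, AddSubgroup.closure_eq,
      ← AddSubgroup.zmultiples_eq_closure] at hz
    obtain ⟨g, hg, k, hk, rfl⟩ := AddSubgroup.mem_sup.1 hz
    have h1 : α (g + k) - (g + k) ∈ AddSubgroup.zmultiples s := by
      have h := step_aux hn S α hinj hC s hs g (g + k) (by simpa using hk)
      rw [hfixG g hg] at h
      have := sub_mem h hk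
      rwa [sub_sub] at this
    have h2 : α (g + k) - (g + k) ∈ G := by
      have h := closure_aux hn S α hinj hC S' hS'S g (hG ▸ hg) k
      rw [hfixs k hk, ← hG] at h
      have := sub_mem h hg
      rwa [sub_sub, add_comm k g] at this
    apply inter_aux hn d hdn
    rw [← addOrderOf_dvd_iff_nsmul_eq_zero, hd]
    refine Nat.dvd_gcd ?_ ?_
    · rw [hn']
      exact AddSubgroup.addOrderOf_dvd_natCard _ h2
    · rw [hr, ← Nat.card_zmultiples s]
      exact AddSubgroup.addOrderOf_dvd_natCard _ h1
  intro x hx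
  apply Set.eq_of_subset_of_ncard_le
  · rintro _ ⟨z, hz, rfl⟩
    have := add_mem (key z (hx hz)) hz
    simpa using this
  · rw [Set.ncard_image_of_injective _ hinj]
  · exact Set.toFinite _
end

section
/- Let n be a positive integer, S ⊆ ℤ_n \ {0} with S = -S, and suppose Circ(n;S) is connected (i.e. ⟨S⟩ = ℤ_n). Let α be a graph automorphism of Circ(n;S) that fixes the vertex 0 and respects the partition 𝒞. Then α is a group automorphism of ℤ_n; that is, there exists a unit j of ℤ_n such that α(x) = j·x for every x ∈ ℤ_n. -/
theorem step_inv {n : ℕ} (S : Set (ZMod n)) (f : ZMod n → ZMod n) (hf : Function.Injective f)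
    (hC : RespectsC S f) (s : ZMod n) (hs : s ∈ S) (x : ZMod n) :
    f (x + s + s) - f (x + s) = f (x + s) - f x := by
  obtain ⟨s', -, x', h⟩ := hC s hs x
  have h1 : s(f x, f (x + s)) ∈ cyclePart s' x' := by
    rw [← h]
    exact ⟨s(x, x + s), ⟨x, by simp, rfl⟩, rfl⟩
  have h2 : s(f (x + s), f (x + s + s)) ∈ cyclePart s' x' := by
    rw [← h]
    exact ⟨s(x + s, x + s + s), ⟨x + s, by simp, rfl⟩, rfl⟩
  have key : f (x + s + s) = f x → s' + s' = 0 := by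
    intro e
    have e2 : x + s + s = x := hf e
    have e3 : s + s = 0 := by linear_combination e2
    have hsing : ∀ e ∈ cyclePart s x, e = s(x, x + s) := by
      rintro _ ⟨g, hg, rfl⟩
      obtain ⟨k, hk⟩ := AddSubgroup.mem_zmultiples_iff.1 hg
      obtain ⟨m, hm | hm⟩ := Int.even_or_odd' k
      · have : g = x := by
          have : k • s = 0 := by rw [hm, mul_comm, mul_smul, two_smul, e3, smul_zero]
          rw [this] at hk
          linear_combination -hk
        rw [this]
      · have : g = x + s := by
          have : k • s = s := by
            rw [hm, add_smul, mul_comm, mul_smul, two_smul, e3, smul_zero, one_smul, zero_add]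
          rw [this] at hk
          linear_combination -hk
        rw [this, e2, Sym2.eq_swap]
    have hsing' : ∀ e ∈ cyclePart s' x', e = s(f x, f (x + s)) := by
      rw [← h]
      rintro _ ⟨e, he, rfl⟩
      rw [hsing e he]; rfl
    have a := hsing' s(x', x' + s') ⟨x', by simp, rfl⟩
    have b := hsing' s(x' + s', x' + s' + s') ⟨x' + s', by simp, rfl⟩
    rw [← a, Sym2.eq_iff] at b
    rcases b with ⟨b1, b2⟩ | ⟨b1, b2⟩
    · linear_combination b2 + b1
    · linear_combination b2
  obtain ⟨g, -, hg⟩ := h1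
  obtain ⟨g', -, hg'⟩ := h2
  rw [Sym2.eq_iff] at hg hg'
  rcases hg with ⟨a, b⟩ | ⟨a, b⟩ <;> rcases hg' with ⟨c, d⟩ | ⟨c, d⟩
  · linear_combination d - c - b + a
  · have := key (by linear_combination d - c + b - a)
    linear_combination d - c - b + a - this
  · have := key (by linear_combination d - c + b - a)
    linear_combination d - c - b + a + this
  · linear_combination d - c - b + a

theorem step_mul {n : ℕ} (f : ZMod n → ZMod n) (s : ZMod n)
    (h : ∀ x, f (x + s + s) - f (x + s) = f (x + s) - f x) (x : ZMod n) (k : ℕ) :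
    f (x + k * s) = f x + k * (f (x + s) - f x) := by
  have : f (x + k * s) = f x + k * (f (x + s) - f x) ∧
      f (x + k * s + s) - f (x + k * s) = f (x + s) - f x := by
    induction k with
    | zero => simp
    | succ k ih =>
      obtain ⟨h1, h2⟩ := ih
      have e : x + ((k + 1 : ℕ) : ZMod n) * s = x + k * s + s := by push_cast; ring
      rw [e]
      refine ⟨?_, (h _).trans h2⟩
      push_cast
      linear_combination h1 + h2
  exact this.1

theorem comm_step {n : ℕ} [NeZero n] (f : ZMod n → ZMod n) (s t : ZMod n) (hs0 : s ≠ 0)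
    (hs : ∀ x, f (x + s + s) - f (x + s) = f (x + s) - f x)
    (ht : ∀ x, f (x + t + t) - f (x + t) = f (x + t) - f x) (x : ZMod n) :
    f (x + t + s) - f (x + t) = f (x + s) - f x := by
  have hpos : 0 < Nat.gcd s.val t.val :=
    Nat.gcd_pos_of_pos_left _ (Nat.pos_of_ne_zero (by simpa using hs0))
  obtain ⟨u, v, hcop, hu, hv⟩ := Nat.exists_coprime s.val t.val
  have hrel : (v : ZMod n) * s = u * t := by
    have : v * s.val = u * t.val := by
      generalize Nat.gcd s.val t.val = g at hu hv
      rw [hu, hv]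
      ring
    have := congrArg (Nat.cast : ℕ → ZMod n) this
    simpa using this
  have hy : ∀ y, (v : ZMod n) * (f (y + s) - f y) = u * (f (y + t) - f y) := by
    intro y
    have a := step_mul f s hs y v
    have b := step_mul f t ht y u
    rw [hrel] at a
    linear_combination b - a
  have e : x + s + t = x + t + s := by ring
  have h0 := hy x
  have h1 := hy (x + s)
  have h2 := hy (x + t)
  rw [hs, e] at h1
  rw [ht] at h2
  have hb : (u : ℤ) * u.gcdA v + v * u.gcdB v = 1 := by
    rw [← Nat.gcd_eq_gcd_ab, hcop.gcd_eq_one]; rfl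
  have hb' := congrArg (Int.cast : ℤ → ZMod n) hb
  push_cast at hb'
  generalize ((u.gcdA v : ℤ) : ZMod n) = p at hb'
  generalize ((u.gcdB v : ℤ) : ZMod n) = q at hb'
  have hd1 : (u : ZMod n) * (f (x + t + s) - f (x + t) - (f (x + s) - f x)) = 0 := by
    linear_combination h0 - h1
  have hd2 : (v : ZMod n) * (f (x + t + s) - f (x + t) - (f (x + s) - f x)) = 0 := by
    linear_combination h2 - h0
  linear_combination p * hd1 + q * hd2 - (f (x + t + s) - f (x + t) - (f (x + s) - f x)) * hb'

theorem main_theorem (n : ℕ) (hn : 0 < n) (S : Set (ZMod n))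
    (h0S : (0 : ZMod n) ∉ S) (hSsym : S = -S)
    (hconn : AddSubgroup.closure S = ⊤)
    (α : Circ n S ≃g Circ n S) (hα0 : α 0 = 0) (hC : RespectsC S ⇑α) :
    ∃ j : (ZMod n)ˣ, ∀ x : ZMod n, α x = (j : ZMod n) * x := by
  haveI : NeZero n := ⟨hn.ne'⟩
  have hst := step_inv S α α.injective hC
  have hadd : ∀ y x, α (x + y) = α x + α y := by
    have hS : ∀ s ∈ S, ∀ y x, α (x + y + s) - α (x + y) = α (x + s) - α x := by
      intro s hs y
      have hy : y ∈ AddSubgroup.closure S := by rw [hconn]; trivial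
      induction hy using AddSubgroup.closure_induction with
      | mem t ht =>
        exact comm_step α s t (fun h => h0S (h ▸ hs)) (hst s hs) (hst t ht)
      | zero => simp
      | add a b _ _ ha hb =>
        intro x
        rw [← add_assoc, hb, ha]
      | neg a _ ha =>
        intro x
        have := ha (x + -a)
        rw [neg_add_cancel_right] at this
        exact this.symm
    intro y
    have hy : y ∈ AddSubgroup.closure S := by rw [hconn]; trivial
    induction hy using AddSubgroup.closure_induction with
    | mem s hs =>
      intro x
      have := hS s hs x 0
      rw [zero_add, zero_add, hα0] at this
      linear_combination this
    | zero => simp [hα0]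
    | add a b _ _ ha hb =>
      intro x
      rw [← add_assoc, hb, ha, hb a, add_assoc]
    | neg a _ ha =>
      intro x
      have h1 := ha (x + -a)
      have h2 := ha (-a)
      rw [neg_add_cancel_right] at h1
      rw [neg_add_cancel, hα0] at h2
      linear_combination h2 - h1
  let F : ZMod n →+ ZMod n := ⟨⟨α, hα0⟩, fun x y => hadd y x⟩
  have hF : ∀ x, α x = α 1 * x := by
    intro x
    have h := map_nsmul F x.val 1
    rw [nsmul_eq_mul, nsmul_eq_mul, mul_one, ZMod.natCast_zmod_val, mul_comm] at h
    exact h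
  obtain ⟨b, hb⟩ := α.surjective 1
  rw [hF] at hb
  exact ⟨Units.mkOfMulEqOne _ _ hb, hF⟩
end

section
/- Let n be a positive integer and let s₁, …, s_{k+1} ∈ ℤ_n. Let S_k = ⟨s₁, …, s_k⟩ and S_{k+1} = ⟨s₁, …, s_{k+1}⟩ be the subgroups of ℤ_n they generate. Define T₀ = S_k ∪ ⟨s_{k+1}⟩ and, for m ≥ 1, T_m = T_{m-1} ∪ {x ∈ S_{k+1} : x − s_{k+1} ∈ T_{m-1} and x − s_y ∈ T_{m-1} for some 1 ≤ y ≤ k}. Then every element of S_{k+1} lies in T_m for some m ≥ 0. -/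
theorem every_element_in_some_Tm (n : ℕ) (hn : 0 < n) (k : ℕ)
    (s : Fin (k + 1) → ZMod n)
    (T : ℕ → Set (ZMod n))
    (hT0 : T 0 =
      ↑(AddSubgroup.closure (Set.range fun i : Fin k => s i.castSucc)) ∪
      ↑(AddSubgroup.zmultiples (s (Fin.last k))))
    (hTsucc : ∀ m : ℕ, T (m + 1) = T m ∪
      {x : ZMod n | x ∈ AddSubgroup.closure (Set.range s) ∧
        x - s (Fin.last k) ∈ T m ∧ ∃ y : Fin k, x - s y.castSucc ∈ T m}) :
    ∀ x ∈ AddSubgroup.closure (Set.range s), ∃ m : ℕ, x ∈ T m := by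
  have : NeZero n := ⟨hn.ne'⟩
  have mono : Monotone T := monotone_nat_of_le_succ fun m => by
    rw [hTsucc m]; exact Set.subset_union_left
  have hsub : ∀ a ∈ AddSubmonoid.closure (Set.range fun i : Fin k => s i.castSucc),
      a ∈ AddSubgroup.closure (Set.range fun i : Fin k => s i.castSucc) := fun a ha =>
    (AddSubmonoid.closure_le (S := (AddSubgroup.closure
      (Set.range fun i : Fin k => s i.castSucc)).toAddSubmonoid)).2
      AddSubgroup.subset_closure ha
  have hle : AddSubgroup.closure (Set.range fun i : Fin k => s i.castSucc) ≤
      AddSubgroup.closure (Set.range s) := by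
    apply AddSubgroup.closure_mono
    rintro _ ⟨i, rfl⟩
    exact ⟨i.castSucc, rfl⟩
  have key : ∀ b : ℕ, ∀ a ∈ AddSubmonoid.closure (Set.range fun i : Fin k => s i.castSucc),
      ∃ m, a + b • s (Fin.last k) ∈ T m := by
    intro b
    induction b with
    | zero =>
      intro a ha
      refine ⟨0, ?_⟩
      rw [hT0, zero_smul, add_zero]
      exact Or.inl (hsub a ha)
    | succ b ihb =>
      intro a ha
      induction ha using AddSubmonoid.closure_induction_left with
      | zero =>
        refine ⟨0, ?_⟩
        rw [hT0, zero_add]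
        exact Or.inr (nsmul_mem (AddSubgroup.mem_zmultiples _) _)
      | add_left g hg a' ha' ih =>
        have hga := add_mem (AddSubmonoid.subset_closure hg) ha'
        obtain ⟨m1, h1⟩ := ih
        obtain ⟨m2, h2⟩ := ihb _ hga
        obtain ⟨y, rfl⟩ := hg
        refine ⟨max m1 m2 + 1, ?_⟩
        rw [hTsucc]
        refine Or.inr ⟨add_mem (hle (hsub _ hga))
          (nsmul_mem (AddSubgroup.subset_closure (Set.mem_range_self _)) _), ?_, y, ?_⟩
        · have := mono (le_max_right m1 m2) h2
          convert this using 1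
          rw [succ_nsmul]; abel
        · have := mono (le_max_left m1 m2) h1
          convert this using 1
          dsimp only; abel
  intro x hx
  rw [← AddSubgroup.mem_toAddSubmonoid, AddSubgroup.closure_toAddSubmonoid_of_finite] at hx
  have hd : ∃ a ∈ AddSubmonoid.closure (Set.range fun i : Fin k => s i.castSucc),
      ∃ b : ℕ, x = a + b • s (Fin.last k) := by
    induction hx using AddSubmonoid.closure_induction with
    | mem x hx =>
      obtain ⟨i, rfl⟩ := hx
      induction i using Fin.lastCases with
      | last => exact ⟨0, zero_mem _, 1, by simp⟩
      | cast i => exact ⟨_, AddSubmonoid.subset_closure ⟨i, rfl⟩, 0, by simp⟩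
    | zero => exact ⟨0, zero_mem _, 0, by simp⟩
    | add x y _ _ hx hy =>
      obtain ⟨a, ha, b, rfl⟩ := hx
      obtain ⟨a', ha', b', rfl⟩ := hy
      exact ⟨a + a', add_mem ha ha', b + b', by rw [add_nsmul]; abel⟩
  obtain ⟨a, ha, b, rfl⟩ := hd
  exact key b a ha
end

section
/- Let n be a positive integer and let s₁, …, s_{k+1} ∈ ℤ_n. Let S_k = ⟨s₁, …, s_k⟩ and S_{k+1} = ⟨s₁, …, s_{k+1}⟩ be the subgroups of ℤ_n they generate, let n' = |S_k|, let r be the order of s_{k+1} in ℤ_n, and let d = gcd(n', r). Define T₀ = S_k ∪ ⟨s_{k+1}⟩ and, for m ≥ 1, T_m = T_{m-1} ∪ {x ∈ S_{k+1} : x − s_{k+1} ∈ T_{m-1} and x − s_y ∈ T_{m-1} for some 1 ≤ y ≤ k}. Then for every m ≥ 0, the set T_m is a union of cosets of the subgroup ⟨n/d⟩ of ℤ_n. -/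
theorem mem_of_card_nsmul (n : ℕ) [NeZero n] (H : AddSubgroup (ZMod n)) (z : ZMod n)
    (h : Nat.card H • z = 0) : z ∈ H := by
  classical
  have h1 := IsAddCyclic.card_nsmul_eq_zero_le (α := ZMod n) (n := Nat.card H) Nat.card_pos
  have h2 : (Finset.univ.filter fun a : ZMod n => a ∈ H) ⊆
      Finset.univ.filter fun a : ZMod n => Nat.card H • a = 0 := by
    intro a ha
    simp only [Finset.mem_filter, Finset.mem_univ, true_and] at ha ⊢
    have := card_nsmul_eq_zero' (x := (⟨a, ha⟩ : H))
    exact congrArg Subtype.val this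
  have h3 : (Finset.univ.filter fun a : ZMod n => a ∈ H).card = Nat.card H := by
    rw [Nat.card_eq_fintype_card, Fintype.card_subtype]
  have h4 := Finset.eq_of_subset_of_card_le h2 (by rw [h3]; convert h1)
  have : z ∈ Finset.univ.filter fun a : ZMod n => Nat.card H • a = 0 := by simpa using h
  rw [← h4] at this
  simpa using this

theorem Tm_union_of_cosets (n : ℕ) (hn : 0 < n) (k : ℕ)
    (s : Fin (k + 1) → ZMod n)
    (n' : ℕ) (hn' : n' = Nat.card (AddSubgroup.closure (Set.range fun i : Fin k => s i.castSucc)))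
    (r : ℕ) (hr : r = addOrderOf (s (Fin.last k)))
    (d : ℕ) (hd : d = Nat.gcd n' r)
    (T : ℕ → Set (ZMod n))
    (hT0 : T 0 =
      ↑(AddSubgroup.closure (Set.range fun i : Fin k => s i.castSucc)) ∪
      ↑(AddSubgroup.zmultiples (s (Fin.last k))))
    (hTsucc : ∀ m : ℕ, T (m + 1) = T m ∪
      {x : ZMod n | x ∈ AddSubgroup.closure (Set.range s) ∧
        x - s (Fin.last k) ∈ T m ∧ ∃ y : Fin k, x - s y.castSucc ∈ T m}) :
    ∀ m : ℕ, ∀ x ∈ T m, ∀ z ∈ AddSubgroup.zmultiples (((n / d : ℕ) : ZMod n)),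
      x + z ∈ T m := by
  haveI : NeZero n := ⟨hn.ne'⟩
  set A := AddSubgroup.closure (Set.range fun i : Fin k => s i.castSucc) with hA
  set B := AddSubgroup.zmultiples (s (Fin.last k)) with hB
  have hrB : r = Nat.card B := by rw [hr, hB, Nat.card_zmultiples]
  have hdn : d ∣ n := by
    have h1 : n' ∣ n := by
      rw [hn']
      simpa using AddSubgroup.card_addSubgroup_dvd_card A
    rw [hd]
    exact (Nat.gcd_dvd_left _ _).trans h1
  have hdz : d • ((n / d : ℕ) : ZMod n) = 0 := by
    rw [nsmul_eq_mul, ← Nat.cast_mul, Nat.mul_div_cancel' hdn, ZMod.natCast_self]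
  have key : ∀ H : AddSubgroup (ZMod n), d ∣ Nat.card H →
      AddSubgroup.zmultiples (((n / d : ℕ) : ZMod n)) ≤ H := by
    intro H hH
    rw [AddSubgroup.zmultiples_le]
    apply mem_of_card_nsmul
    obtain ⟨c, hc⟩ := hH
    rw [hc, mul_comm, mul_nsmul', hdz, nsmul_zero]
  have kA := key A (by rw [hd, ← hn']; exact Nat.gcd_dvd_left _ _)
  have kB := key B (by rw [hd, ← hrB]; exact Nat.gcd_dvd_right _ _)
  have hAC : A ≤ AddSubgroup.closure (Set.range s) := by
    apply AddSubgroup.closure_mono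
    rintro _ ⟨i, rfl⟩
    exact ⟨i.castSucc, rfl⟩
  intro m
  induction m with
  | zero =>
    intro x hx z hz
    rw [hT0] at hx ⊢
    rcases hx with hx | hx
    · exact Or.inl (A.add_mem hx (kA hz))
    · exact Or.inr (B.add_mem hx (kB hz))
  | succ m ih =>
    intro x hx z hz
    rw [hTsucc] at hx ⊢
    rcases hx with hx | ⟨h1, h2, y, h3⟩
    · exact Or.inl (ih x hx z hz)
    · refine Or.inr ⟨add_mem h1 (hAC (kA hz)), ?_, y, ?_⟩
      · rw [add_sub_right_comm]; exact ih _ h2 z hz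
      · rw [add_sub_right_comm]; exact ih _ h3 z hz
end
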